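/- Fix integers n ≥ 2 and 1 ≤ k ≤ n. Let σₖ(λ) = ∑_{1 ≤ i₁ < i₂ < ⋯ < iₖ ≤ n} λ_{i₁} λ_{i₂} ⋯ λ_{iₖ} denote the k-th elementary symmetric polynomial on ℝⁿ, and let Γₖ = {λ ∈ ℝⁿ : σⱼ(λ) > 0 for all j = 1,…,k} be the k-th Gårding cone. Then the normalized k-Hessian operator f = σₖ^{1/k} satisfies Condition (T) on Γₖ: there exists a constant 𝒯 > 0, depending only on n and k, such that ∏_{i=1}^{n} ∂f/∂λᵢ(λ) ≥ 𝒯 for all λ ∈ Γₖ. -/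

import Mathlib

open Finset

/-- The `k`-th elementary symmetric polynomial `σₖ` on `ℝⁿ`. -/
noncomputable def esymmPoly (n k : ℕ) (x : Fin n → ℝ) : ℝ :=
  ∑ s ∈ Finset.powersetCard k (Finset.univ : Finset (Fin n)), ∏ i ∈ s, x i

/-- The Gårding cone `Γₖ = {λ : σⱼ(λ) > 0 for j = 1, …, k}`. -/
def gardingCone (n k : ℕ) : Set (Fin n → ℝ) :=
  {x | ∀ j : ℕ, 1 ≤ j → j ≤ k → 0 < esymmPoly n j x}

section RealRooted

open Polynomial

theorem Polynomial.Splits.derivative_real {p : ℝ[X]} (hp : p.Splits) : p.derivative.Splits := by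
  have h1 := card_roots_le_derivative p
  have h2 := p.derivative.card_roots'
  have h3 := natDegree_derivative_le p
  have h4 := splits_iff_card_roots.1 hp
  rcases Nat.eq_zero_or_pos p.natDegree with h | h
  · exact Splits.of_natDegree_eq_zero (by omega)
  · exact splits_iff_card_roots.2 (by omega)

theorem Polynomial.Splits.iterate_derivative_real {p : ℝ[X]} (hp : p.Splits) (m : ℕ) :
    (derivative^[m] p).Splits := by
  induction m with
  | zero => exact hp
  | succ m ih => rw [Function.iterate_succ_apply']; exact ih.derivative_real

/-- Laguerre's inequality for real-rooted polynomials. -/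
theorem Polynomial.Splits.eval_mul_eval_derivative_le {p : ℝ[X]} (hp : p.Splits) (x : ℝ) :
    p.eval x * p.derivative.derivative.eval x ≤ p.derivative.eval x ^ 2 := by
  obtain ⟨m, hm⟩ := splits_iff_exists_multiset.1 hp
  rw [hm]
  suffices h : ∀ m : Multiset ℝ, (m.map (X - C ·)).prod.eval x *
      (m.map (X - C ·)).prod.derivative.derivative.eval x ≤
      (m.map (X - C ·)).prod.derivative.eval x ^ 2 by
    simp only [derivative_C_mul, eval_mul, eval_C]
    nlinarith [mul_le_mul_of_nonneg_left (h m) (sq_nonneg p.leadingCoeff)]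
  intro m
  induction m using Multiset.induction_on with
  | empty => simp
  | cons a m ih =>
    simp only [Multiset.map_cons, Multiset.prod_cons, derivative_mul, derivative_sub, derivative_X,
      derivative_C, sub_zero, one_mul, derivative_add, eval_add, eval_mul, eval_sub, eval_X, eval_C]
    generalize (m.map (X - C ·)).prod = q at *
    nlinarith [mul_le_mul_of_nonneg_left ih (sq_nonneg (x - a)), sq_nonneg (q.eval x)]

theorem Polynomial.Splits.coeff_mul_coeff_le {p : ℝ[X]} (hp : p.Splits) (m : ℕ) :
    (m + 2) * (p.coeff m * p.coeff (m + 2)) ≤ (m + 1) * p.coeff (m + 1) ^ 2 := by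
  have h := (hp.iterate_derivative_real m).eval_mul_eval_derivative_le 0
  have e : ∀ l, (derivative^[l] p).eval 0 = l.factorial * p.coeff l := fun l => by
    rw [← coeff_zero_eq_eval_zero, coeff_iterate_derivative]
    simp [Nat.descFactorial_self]
  rw [← Function.iterate_succ_apply' derivative, ← Function.iterate_succ_apply' derivative,
    e, e, e, Nat.factorial_succ, Nat.factorial_succ] at h
  push_cast at h
  refine le_of_mul_le_mul_left ?_ (by positivity : 0 < (m.factorial : ℝ) ^ 2 * (m + 1))
  linear_combination h

theorem Polynomial.roots_derivative_im_neg {P : ℂ[X]} (hd : 0 < P.natDegree)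
    (h : ∀ z, P.eval z = 0 → z.im < 0) (z : ℂ) (hz : P.derivative.eval z = 0) : z.im < 0 := by
  have hd' : 0 < P.degree := natDegree_pos_iff_degree_pos.1 hd
  have hD : P.derivative ≠ 0 := fun h0 => hd.ne' (derivative_eq_zero.1 h0)
  have hmem : z ∈ P.derivative.rootSet ℂ := by
    rw [mem_rootSet]; exact ⟨hD, by simpa using hz⟩
  refine convexHull_min ?_ (convex_halfSpace_im_lt 0)
    (rootSet_derivative_subset_convexHull_rootSet hd' hmem)
  intro w hw
  rw [mem_rootSet] at hw
  exact h w (by simpa using hw.2)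

theorem Polynomial.natDegree_iterate_derivative_eq {R : Type*} [Semiring R] [IsAddTorsionFree R]
    (p : R[X]) (m : ℕ) : (derivative^[m] p).natDegree = p.natDegree - m := by
  induction m with
  | zero => simp
  | succ m ih => rw [Function.iterate_succ_apply', natDegree_derivative, ih, Nat.sub_sub]

theorem Polynomial.roots_iterate_derivative_im_neg {P : ℂ[X]}
    (h : ∀ z, P.eval z = 0 → z.im < 0) {m : ℕ} (hm : m ≤ P.natDegree) (z : ℂ)
    (hz : (derivative^[m] P).eval z = 0) : z.im < 0 := by
  induction m generalizing z with
  | zero => exact h z hz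
  | succ m ih =>
    rw [Function.iterate_succ_apply'] at hz
    refine roots_derivative_im_neg ?_ (fun w hw => ih (by omega) w hw) z hz
    rw [natDegree_iterate_derivative_eq]
    omega

/-- Elementary symmetric polynomials do not vanish on the upper half plane. -/
theorem Finset.sum_powersetCard_prod_ne_zero_of_im_pos {ι : Type*} (s : Finset ι) {k : ℕ}
    (hk : k ≤ #s) (z : ι → ℂ) (hz : ∀ i ∈ s, 0 < (z i).im) :
    ∑ t ∈ s.powersetCard k, ∏ i ∈ t, z i ≠ 0 := by
  intro h0
  have hdeg : (∏ i ∈ s, (X + C (z i))).natDegree = #s := by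
    rw [natDegree_prod_of_monic _ _ fun i _ => monic_X_add_C _]
    simp
  have hroot : ∀ w : ℂ, (∏ i ∈ s, (X + C (z i))).eval w = 0 → w.im < 0 := fun w hw => by
    rw [eval_prod, Finset.prod_eq_zero_iff] at hw
    obtain ⟨i, hi, hw⟩ := hw
    have := congrArg Complex.im hw
    simp at this
    linarith [hz i hi]
  refine lt_irrefl (0 : ℝ) (roots_iterate_derivative_im_neg hroot (m := #s - k) (by omega) 0 ?_)
  rw [← coeff_zero_eq_eval_zero, coeff_iterate_derivative, zero_add,
    Finset.prod_X_add_C_coeff s z (Nat.sub_le _ _), Nat.sub_sub_self hk, h0, smul_zero]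

theorem Polynomial.splits_of_aeval_eq_zero_im_eq_zero {q : ℝ[X]}
    (h : ∀ z : ℂ, aeval z q = 0 → z.im = 0) : q.Splits := by
  rcases eq_or_ne q 0 with rfl | h0
  · exact Splits.zero
  refine (IsAlgClosed.splits (q.map (algebraMap ℝ ℂ))).of_splits_map _ fun z hz => ?_
  have := h z (by
    have := (mem_roots'.1 hz).2
    rwa [IsRoot, eval_map_algebraMap] at this)
  exact ⟨z.re, Complex.ext (by simp) (by simp [this])⟩

/-- For a real-rooted polynomial of degree `k` which is positive on `[0, ∞)`, a weak form of the
arithmetic-geometric mean inequality for the inverses of its roots. -/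
theorem Polynomial.Splits.leadingCoeff_mul_pow_le {q : ℝ[X]} (hq : q.Splits)
    (hpos : ∀ t, 0 ≤ t → 0 < q.eval t) (hd : 1 ≤ q.natDegree) :
    q.leadingCoeff * q.eval 0 ^ (q.natDegree - 1) ≤ q.derivative.eval 0 ^ q.natDegree := by
  have h0 : 0 < q.eval 0 := hpos 0 le_rfl
  have hr : ∀ r ∈ q.roots, r < 0 := fun r hr => by
    by_contra! h
    exact (hpos r h).ne' (isRoot_of_mem_roots hr)
  have hS := hq.eval_derivative_div_eval_of_ne_zero h0.ne'
  set S := (q.roots.map fun z => 1 / (0 - z)).sum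
  have hterm : ∀ a ∈ q.roots.map (fun z => 1 / (0 - z)), 0 ≤ a := fun a ha => by
    obtain ⟨r, hr', rfl⟩ := Multiset.mem_map.1 ha
    have := hr r hr'
    exact one_div_nonneg.2 (by linarith)
  have hle : (q.roots.map fun z => 1 / (0 - z)).prod ≤ S ^ q.natDegree := by
    have hle' : (q.roots.map fun z => 1 / (0 - z)).prod ≤
        (q.roots.map fun _ => S).prod := by
      refine Multiset.prod_map_le_prod_map₀ _ _ (fun r hr' => ?_) fun r hr' => ?_
      · exact hterm _ (Multiset.mem_map_of_mem _ hr')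
      · exact Multiset.single_le_sum hterm _ (Multiset.mem_map_of_mem _ hr')
    rwa [Multiset.map_const', Multiset.prod_replicate, splits_iff_card_roots.1 hq] at hle'
  have hprod : (q.roots.map fun z => 1 / (0 - z)).prod * q.eval 0 = q.leadingCoeff := by
    have hne : (q.roots.map fun z => 0 - z).prod ≠ 0 := fun h => by
      obtain ⟨r, hr', h⟩ := Multiset.mem_map.1 (Multiset.prod_eq_zero_iff.1 h)
      linarith [hr r hr']
    rw [hq.eval_eq_prod_roots 0, mul_left_comm, ← Multiset.prod_map_mul,
      Multiset.map_congr rfl (g := fun _ => (1 : ℝ)), Multiset.map_const', Multiset.prod_replicate,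
      one_pow, mul_one]
    intro r hr'
    exact one_div_mul_cancel (by linarith [hr r hr'])
  have hD : q.derivative.eval 0 = S * q.eval 0 := by rw [← hS, div_mul_cancel₀ _ h0.ne']
  rw [← hprod, hD, mul_pow, mul_assoc, ← pow_succ', Nat.sub_add_cancel hd]
  exact mul_le_mul_of_nonneg_right hle (by positivity)

end RealRooted

section ElementarySymmetric

variable {ι : Type*}

/-- The elementary symmetric polynomial of degree `k` in the variables indexed by `s`. -/
noncomputable def esymmOn (s : Finset ι) (k : ℕ) (x : ι → ℝ) : ℝ :=
  ∑ t ∈ s.powersetCard k, ∏ i ∈ t, x i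

theorem esymmOn_zero (s : Finset ι) (x : ι → ℝ) : esymmOn s 0 x = 1 := by
  simp [esymmOn]

theorem esymmOn_insert_succ [DecidableEq ι] {s : Finset ι} {i : ι} (hi : i ∉ s) (k : ℕ)
    (x : ι → ℝ) :
    esymmOn (insert i s) (k + 1) x = esymmOn s (k + 1) x + x i * esymmOn s k x := by
  have hmem : ∀ {t}, t ∈ s.powersetCard k → i ∉ t := fun ht h => hi ((mem_powersetCard.1 ht).1 h)
  rw [esymmOn, powersetCard_succ_insert hi, sum_union, sum_image, esymmOn, esymmOn, mul_sum]
  · congr 1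
    exact sum_congr rfl fun t ht => prod_insert (hmem ht)
  · intro t ht u hu h
    rw [← erase_insert (hmem ht), h, erase_insert (hmem hu)]
  · refine disjoint_left.2 fun t ht hu => ?_
    obtain ⟨u, -, rfl⟩ := mem_image.1 hu
    exact hi ((mem_powersetCard.1 ht).1 (mem_insert_self i u))

theorem esymmOn_congr {s : Finset ι} {x y : ι → ℝ} (h : ∀ i ∈ s, x i = y i) (k : ℕ) :
    esymmOn s k x = esymmOn s k y :=
  sum_congr rfl fun _ ht => prod_congr rfl fun i hi => h i ((mem_powersetCard.1 ht).1 hi)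

/-- A weak form of Newton's inequality. -/
theorem esymmOn_mul_le_sq (s : Finset ι) (k : ℕ) (x : ι → ℝ) :
    esymmOn s k x * esymmOn s (k + 2) x ≤ esymmOn s (k + 1) x ^ 2 := by
  rcases lt_or_ge #s (k + 2) with hs | hs
  · rw [esymmOn, esymmOn, powersetCard_eq_empty.2 hs, sum_empty, mul_zero]
    positivity
  obtain ⟨m, hm⟩ := Nat.exists_eq_add_of_le hs
  have hp : (∏ i ∈ s, (Polynomial.X + Polynomial.C (x i))).Splits :=
    Polynomial.Splits.prod fun i _ => Polynomial.Splits.X_add_C _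
  have h := hp.coeff_mul_coeff_le m
  rw [prod_X_add_C_coeff s x (by omega), prod_X_add_C_coeff s x (by omega),
    prod_X_add_C_coeff s x (by omega), show #s - m = k + 2 by omega,
    show #s - (m + 1) = k + 1 by omega, show #s - (m + 2) = k by omega] at h
  change (m + 2 : ℝ) * (esymmOn s (k + 2) x * esymmOn s k x) ≤
    (m + 1) * esymmOn s (k + 1) x ^ 2 at h
  have hm' : (0 : ℝ) ≤ m := m.cast_nonneg
  nlinarith [sq_nonneg (esymmOn s (k + 1) x)]

theorem esymmOn_pos_of_insert [DecidableEq ι] {s : Finset ι} {i : ι} (hi : i ∉ s) (x : ι → ℝ)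
    (k : ℕ) (h : ∀ j ≤ k + 1, 0 < esymmOn (insert i s) j x) : 0 < esymmOn s k x := by
  induction k with
  | zero => simp [esymmOn_zero]
  | succ k ih =>
    have ha := ih fun j hj => h j (by omega)
    have h1 := h (k + 1) (by omega)
    have h2 := h (k + 2) le_rfl
    rw [esymmOn_insert_succ hi] at h1 h2
    by_contra! hb
    have hx : 0 < x i := pos_of_mul_pos_left (by linarith) ha.le
    have hc : 0 < esymmOn s (k + 2) x := by nlinarith
    have := esymmOn_mul_le_sq s k x
    nlinarith [mul_pos ha h2]


variable [Fintype ι]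

theorem differentiable_esymmOn (s : Finset ι) (k : ℕ) : Differentiable ℝ (esymmOn s k) := by
  unfold esymmOn
  fun_prop

variable [DecidableEq ι]

theorem esymmOn_erase_pos {x : ι → ℝ} {k : ℕ} (h : ∀ j ≤ k + 1, 0 < esymmOn univ j x) (i : ι) :
    0 < esymmOn (univ.erase i) k x :=
  esymmOn_pos_of_insert (notMem_erase i univ) x k (by rwa [insert_erase (mem_univ i)])

theorem esymmOn_add_single (k : ℕ) (x : ι → ℝ) (i : ι) (c : ℝ) :
    esymmOn univ (k + 1) (x + Pi.single i c) =
      esymmOn univ (k + 1) x + c * esymmOn (univ.erase i) k x := by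
  have hc : ∀ l, esymmOn (univ.erase i) l (x + Pi.single i c) = esymmOn (univ.erase i) l x :=
    esymmOn_congr fun j hj => by simp [Pi.single_eq_of_ne (ne_of_mem_erase hj)]
  rw [← insert_erase (mem_univ i), esymmOn_insert_succ (notMem_erase i univ),
    esymmOn_insert_succ (notMem_erase i univ), erase_insert (notMem_erase i univ), hc, hc]
  simp only [Pi.add_apply, Pi.single_eq_same]
  ring

theorem esymmOn_add_pos {x : ι → ℝ} {k : ℕ} (h : ∀ j ≤ k, 0 < esymmOn univ j x) {v : ι → ℝ}
    (hv : ∀ i, 0 ≤ v i) : ∀ j ≤ k, 0 < esymmOn univ j (x + v) := by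
  suffices hs : ∀ s : Finset ι, ∀ j ≤ k, 0 < esymmOn univ j (x + ∑ i ∈ s, Pi.single i (v i)) by
    simpa only [univ_sum_single] using hs univ
  intro s
  induction s using Finset.induction_on with
  | empty => simpa using h
  | insert i s hi ih =>
    intro j hj
    rw [sum_insert hi, add_left_comm, add_comm]
    cases j with
    | zero => simp [esymmOn_zero]
    | succ j =>
      rw [esymmOn_add_single]
      have := esymmOn_erase_pos (fun l hl => ih l (hl.trans hj)) i
      have := ih (j + 1) hj
      have := hv i
      positivity

theorem fderiv_esymmOn_single (k : ℕ) (x : ι → ℝ) (i : ι) :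
    fderiv ℝ (esymmOn univ (k + 1)) x (Pi.single i 1) = esymmOn (univ.erase i) k x := by
  rw [← (differentiable_esymmOn univ (k + 1) x).lineDeriv_eq_fderiv]
  refine HasLineDerivAt.lineDeriv ?_
  have : HasDerivAt (fun t : ℝ => esymmOn univ (k + 1) x + t * esymmOn (univ.erase i) k x)
      (esymmOn (univ.erase i) k x) 0 := by
    simpa using ((hasDerivAt_id (0 : ℝ)).mul_const (esymmOn (univ.erase i) k x)).const_add
      (esymmOn univ (k + 1) x)
  refine this.congr_of_eventuallyEq (.of_forall fun t => ?_)
  simp only [← Pi.single_smul, smul_eq_mul, mul_one, esymmOn_add_single]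

open Polynomial in
/-- A weak form of Gårding's inequality for the elementary symmetric polynomials. -/
theorem esymmOn_mul_pow_le {x v : ι → ℝ} {k : ℕ} (hk : k + 1 ≤ Fintype.card ι)
    (hx : ∀ j ≤ k + 1, 0 < esymmOn univ j x) (hv : ∀ i, 0 < v i) :
    esymmOn univ (k + 1) v * esymmOn univ (k + 1) x ^ k ≤
      (∑ i, v i * esymmOn (univ.erase i) k x) ^ (k + 1) := by
  let q : ℝ[X] := ∑ t ∈ powersetCard (k + 1) univ, ∏ i ∈ t, (C (x i) + C (v i) * X)
  have heval : ∀ t : ℝ, q.eval t = esymmOn univ (k + 1) (x + t • v) := fun t => by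
    simp [q, esymmOn, eval_finsetSum, eval_prod, mul_comm t]
  have hlin : ∀ i, (C (x i) + C (v i) * X).natDegree ≤ 1 := fun i => by compute_degree
  have hdeg_le : q.natDegree ≤ k + 1 := by
    refine natDegree_sum_le_of_forall_le _ _ fun t ht => (natDegree_prod_le _ _).trans ?_
    refine (sum_le_card_nsmul _ _ 1 fun i _ => hlin i).trans ?_
    simp [(mem_powersetCard.1 ht).2]
  have hcoeff : q.coeff (k + 1) = esymmOn univ (k + 1) v := by
    rw [finsetSum_coeff]
    refine sum_congr rfl fun t ht => ?_
    have := coeff_prod_of_natDegree_le t (fun i => C (x i) + C (v i) * X) 1 fun i _ => hlin i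
    rw [(mem_powersetCard.1 ht).2, mul_one] at this
    rw [this]
    simp [coeff_C]
  have hvpos : 0 < esymmOn univ (k + 1) v :=
    sum_pos (fun t _ => prod_pos fun i _ => hv i) (powersetCard_nonempty.2 (by simpa using hk))
  have hdeg : q.natDegree = k + 1 :=
    natDegree_eq_of_le_of_coeff_ne_zero hdeg_le (hcoeff ▸ hvpos.ne')
  have haeval : ∀ z : ℂ, aeval z q =
      ∑ t ∈ powersetCard (k + 1) univ, ∏ i ∈ t, ((x i : ℂ) + v i * z) := fun z => by
    simp [q]
  have hnonneg : ∀ z : ℂ, aeval z q = 0 → z.im ≤ 0 := fun z hz => by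
    by_contra! him
    refine sum_powersetCard_prod_ne_zero_of_im_pos univ (by simpa using hk) _ (fun i _ => ?_)
      ((haeval z).symm.trans hz)
    simpa using mul_pos (hv i) him
  have hsplits : q.Splits := splits_of_aeval_eq_zero_im_eq_zero fun z hz => by
    refine le_antisymm (hnonneg z hz) ?_
    have := hnonneg (starRingEnd ℂ z) (by rw [aeval_conj, hz, map_zero])
    simpa using this
  have hmain := hsplits.leadingCoeff_mul_pow_le (fun t ht => by
    rw [heval]
    exact esymmOn_add_pos hx (fun i => mul_nonneg ht (hv i).le) _ le_rfl) (by omega)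
  have hD : q.derivative.eval 0 = ∑ i, v i * esymmOn (univ.erase i) k x := by
    have h1 : HasDerivAt (fun t : ℝ => esymmOn univ (k + 1) (x + t • v)) (q.derivative.eval 0) 0 :=
      (q.hasDerivAt 0).congr_of_eventuallyEq (.of_forall fun t => (heval t).symm)
    have h2 := (differentiable_esymmOn univ (k + 1) x).hasFDerivAt.hasLineDerivAt v
    rw [h1.unique h2, ← ContinuousLinearMap.coe_coe, LinearMap.pi_apply_eq_sum_univ]
    refine sum_congr rfl fun i _ => ?_
    rw [smul_eq_mul, ← fderiv_esymmOn_single]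
    congr 1
    simp only [ContinuousLinearMap.coe_coe]
    congr 1
    funext j
    simp [Pi.single_apply, eq_comm]
  rwa [leadingCoeff, hdeg, hcoeff, hD, heval, zero_smul, add_zero, Nat.add_sub_cancel] at hmain

end ElementarySymmetric

/-- A weak form of Maclaurin's inequality, comparing `σₖ` with the product of the variables. -/
theorem prod_pow_le_esymmOn_pow {n k : ℕ} (hkn : k ≤ n) {v : Fin n → ℝ} (hv : ∀ i, 0 < v i) :
    (∏ i, v i) ^ k ≤ esymmOn univ k v ^ n := by
  rcases Nat.eq_zero_or_pos n with rfl | hn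
  · obtain rfl : k = 0 := by omega
    simp
  have : NeZero n := ⟨hn.ne'⟩
  have hshift : ∀ j : Fin n, ∏ l : Fin k, v (Fin.castLE hkn l + j) ≤ esymmOn univ k v := fun j => by
    have hinj : Function.Injective fun l : Fin k => Fin.castLE hkn l + j := fun a b h =>
      Fin.castLE_injective hkn (add_right_cancel h)
    refine (prod_map univ ⟨_, hinj⟩ v).symm.trans_le ?_
    exact single_le_sum (f := fun t => ∏ i ∈ t, v i)
      (fun t _ => prod_nonneg fun i _ => (hv i).le) (mem_powersetCard.2 ⟨subset_univ _, by simp⟩)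
  calc (∏ i, v i) ^ k = ∏ l : Fin k, ∏ j, v (Fin.castLE hkn l + j) := by
        have h (l : Fin k) : ∏ j, v (Fin.castLE hkn l + j) = ∏ i, v i :=
          Equiv.prod_comp (Equiv.addLeft (Fin.castLE hkn l)) v
        simp [h]
    _ = ∏ j, ∏ l : Fin k, v (Fin.castLE hkn l + j) := prod_comm
    _ ≤ ∏ _j : Fin n, esymmOn univ k v :=
        prod_le_prod (fun j _ => prod_nonneg fun l _ => (hv _).le) fun j _ => hshift j
    _ = esymmOn univ k v ^ n := by simp

/-- **Condition (T) for the normalized `k`-Hessian operator (Remark 1.2 (i)).**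
For `f = σₖ^(1/k)` on the Gårding cone `Γₖ` there is a uniform constant `𝒯 > 0`,
depending only on `n` and `k`, with `∏ᵢ ∂f/∂λᵢ(λ) ≥ 𝒯` for all `λ ∈ Γₖ`. -/
theorem stmt_5 (n k : ℕ) (hn : 2 ≤ n) (hk1 : 1 ≤ k) (hkn : k ≤ n) :
    ∃ 𝒯 : ℝ, 0 < 𝒯 ∧
      ∀ x ∈ gardingCone n k,
        𝒯 ≤ ∏ i, fderiv ℝ (fun y : Fin n → ℝ => (esymmPoly n k y) ^ ((1 : ℝ) / k)) x
              (Pi.single i 1) := by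
  obtain ⟨k, rfl⟩ : ∃ m, k = m + 1 := ⟨k - 1, by omega⟩
  have hn0 : (0 : ℝ) < n := by exact_mod_cast (by omega : 0 < n)
  refine ⟨(((k + 1 : ℕ) * n : ℝ) ^ n)⁻¹, by positivity, fun x hx => ?_⟩
  have hpos : ∀ j ≤ k + 1, 0 < esymmOn univ j x := fun j hj => by
    rcases Nat.eq_zero_or_pos j with rfl | h
    · simp [esymmOn_zero]
    · exact hx j h hj
  set b : Fin n → ℝ := fun i => esymmOn (univ.erase i) k x with hb
  have hbpos : ∀ i, 0 < b i := esymmOn_erase_pos hpos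
  have hB : 0 < ∏ i, b i := prod_pos fun i _ => hbpos i
  set g := esymmOn univ (k + 1) x with hg
  have hgpos : 0 < g := hpos _ le_rfl
  set r := g ^ ((1 : ℝ) / (k + 1 : ℕ)) with hr
  have hrpos : 0 < r := Real.rpow_pos_of_pos hgpos _
  have hrg : r ^ (k + 1) = g := by
    rw [hr, one_div, Real.rpow_inv_natCast_pow hgpos.le (Nat.succ_ne_zero k)]
  have hderiv : ∀ i, fderiv ℝ (fun y : Fin n → ℝ => (esymmPoly n (k + 1) y) ^
      ((1 : ℝ) / (k + 1 : ℕ))) x (Pi.single i 1) = b i / ((k + 1 : ℕ) * r ^ k) := fun i => by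
    have h := ((differentiable_esymmOn univ (k + 1) x).hasFDerivAt.rpow_const
      (p := (1 : ℝ) / (k + 1 : ℕ)) (Or.inl hgpos.ne')).fderiv
    change fderiv ℝ (fun y => esymmOn univ (k + 1) y ^ ((1 : ℝ) / (k + 1 : ℕ))) x _ = _
    rw [h, _root_.smul_apply, fderiv_esymmOn_single, Real.rpow_sub_one hgpos.ne',
      smul_eq_mul, ← hr, ← hrg]
    simp only [hb]
    field_simp
    ring
  have hgarding := esymmOn_mul_pow_le (v := fun i => (b i)⁻¹) (by simpa using hkn) hpos
    fun i => inv_pos.2 (hbpos i)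
  have hsum : ∑ i, (b i)⁻¹ * esymmOn (univ.erase i) k x = n := by
    rw [sum_congr rfl fun i _ => inv_mul_cancel₀ (hbpos i).ne']
    simp
  have hmac := prod_pow_le_esymmOn_pow hkn (v := fun i => (b i)⁻¹) fun i => inv_pos.2 (hbpos i)
  rw [prod_inv_distrib] at hmac
  rw [hsum, ← hg, ← hrg] at hgarding
  have hkey : ((∏ i, b i)⁻¹ * (r ^ k) ^ n) ^ (k + 1) ≤ ((n : ℝ) ^ n) ^ (k + 1) := by
    calc ((∏ i, b i)⁻¹ * (r ^ k) ^ n) ^ (k + 1)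
        = ((∏ i, b i)⁻¹) ^ (k + 1) * (((r ^ (k + 1)) ^ k)) ^ n := by ring
      _ ≤ esymmOn univ (k + 1) (fun i => (b i)⁻¹) ^ n * (((r ^ (k + 1)) ^ k)) ^ n := by gcongr
      _ = (esymmOn univ (k + 1) (fun i => (b i)⁻¹) * (r ^ (k + 1)) ^ k) ^ n := (mul_pow ..).symm
      _ ≤ ((n : ℝ) ^ (k + 1)) ^ n := by
          refine pow_le_pow_left₀ (mul_nonneg ?_ (by positivity)) hgarding n
          exact sum_nonneg fun t _ => prod_nonneg fun i _ => (inv_pos.2 (hbpos i)).le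
      _ = ((n : ℝ) ^ n) ^ (k + 1) := by ring
  have hroot := (pow_le_pow_iff_left₀ (by positivity) (by positivity) (Nat.succ_ne_zero k)).1 hkey
  rw [prod_congr rfl fun i _ => hderiv i, prod_div_distrib, prod_const, card_univ, Fintype.card_fin,
    mul_pow, mul_pow, inv_le_comm₀ (by positivity) (by positivity), inv_div]
  calc ((k + 1 : ℕ) : ℝ) ^ n * (r ^ k) ^ n / ∏ i, b i
      = ((k + 1 : ℕ) : ℝ) ^ n * ((∏ i, b i)⁻¹ * (r ^ k) ^ n) := by ring
    _ ≤ ((k + 1 : ℕ) : ℝ) ^ n * (n : ℝ) ^ n := by gcongr
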